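/- arXiv:2605.00099 — 9 statements merged into one kernel-verified Lean document; each statement's English description precedes it below -/
import Mathlib

section
/- Let n ≥ 1 and let μ be the Haar probability measure on O(2n). Then for all antisymmetric real 2n×2n matrices A, B, B', ∫_{O(2n)} Tr(Aᵀ Q B Qᵀ) · Tr(Aᵀ Q B' Qᵀ) dμ(Q) = Tr(Aᵀ A) · Tr(Bᵀ B') / (n(2n−1)). (This is the paper's exact two-Majorana (B₂) covariance: the exact kernel κ = (1/(n(2n−1)))·‖O‖²_{B₂}·⟨ρ,ρ'⟩_{B₂}, where n(2n−1) = dim(B₂).) -/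
open MeasureTheory Matrix

instance (d : ℕ) : MeasurableSpace (Matrix (Fin d) (Fin d) ℝ) :=
  (inferInstance : MeasurableSpace (Fin d → Fin d → ℝ))

namespace Matrix

variable {d : ℕ}

/-- The entry of `Q * B * Qᵀ` as a double sum. -/
lemma mul_mul_transpose_entry (Q B : Matrix (Fin d) (Fin d) ℝ) (i j : Fin d) :
    (Q * B * Qᵀ) i j = ∑ l, ∑ k, Q i k * B k l * Q j l := by
  simp [mul_apply, Finset.sum_mul]

lemma measurable_mul_mul_transpose_entry (B : Matrix (Fin d) (Fin d) ℝ) (i j : Fin d) :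
    Measurable fun Q : Matrix (Fin d) (Fin d) ℝ => (Q * B * Qᵀ) i j := by
  have h (a b : Fin d) : Measurable fun Q : Matrix (Fin d) (Fin d) ℝ => Q a b :=
    (measurable_pi_apply b).comp (measurable_pi_apply (X := fun _ : Fin d => Fin d → ℝ) a)
  simp only [mul_mul_transpose_entry]
  exact Finset.measurable_sum _ fun l _ => Finset.measurable_sum _ fun k _ =>
    ((h i k).mul_const _).mul (h j l)

lemma measurable_const_mul_left (g : Matrix (Fin d) (Fin d) ℝ) :
    Measurable fun Q : Matrix (Fin d) (Fin d) ℝ => g * Q := by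
  have h (a b : Fin d) : Measurable fun Q : Matrix (Fin d) (Fin d) ℝ => Q a b :=
    (measurable_pi_apply b).comp (measurable_pi_apply (X := fun _ : Fin d => Fin d → ℝ) a)
  refine measurable_pi_lambda (X := fun _ : Fin d => Fin d → ℝ) _ fun i =>
    measurable_pi_lambda _ fun j => ?_
  simp only [mul_apply]
  exact Finset.measurable_sum _ fun k _ => (h k j).const_mul _

lemma abs_entry_le_one {Q : Matrix (Fin d) (Fin d) ℝ} (hQ : Q * Qᵀ = 1) (i j : Fin d) :
    |Q i j| ≤ 1 :=
  entry_norm_bound_of_unitary (U := Q) (mem_unitaryGroup_iff.2 hQ) i j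

lemma abs_mul_mul_transpose_entry_le {Q : Matrix (Fin d) (Fin d) ℝ} (hQ : Q * Qᵀ = 1)
    (B : Matrix (Fin d) (Fin d) ℝ) (i j : Fin d) :
    |(Q * B * Qᵀ) i j| ≤ ∑ l, ∑ k, |B k l| := by
  rw [mul_mul_transpose_entry]
  refine (Finset.abs_sum_le_sum_abs _ _).trans (Finset.sum_le_sum fun l _ =>
    (Finset.abs_sum_le_sum_abs _ _).trans (Finset.sum_le_sum fun k _ => ?_))
  rw [abs_mul, abs_mul]
  calc |Q i k| * |B k l| * |Q j l| ≤ 1 * |B k l| * 1 := by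
        gcongr <;> exact abs_entry_le_one hQ _ _
    _ = |B k l| := by ring

lemma mul_mul_transpose_antisymm {B : Matrix (Fin d) (Fin d) ℝ} (hB : Bᵀ = -B)
    (Q : Matrix (Fin d) (Fin d) ℝ) (i j : Fin d) :
    (Q * B * Qᵀ) j i = -(Q * B * Qᵀ) i j := by
  have h : (Q * B * Qᵀ)ᵀ = -(Q * B * Qᵀ) := by
    simp [transpose_mul, hB, Matrix.mul_assoc]
  simpa using congrFun₂ h i j

lemma mul_mul_transpose_diag {B : Matrix (Fin d) (Fin d) ℝ} (hB : Bᵀ = -B)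
    (Q : Matrix (Fin d) (Fin d) ℝ) (i : Fin d) : (Q * B * Qᵀ) i i = 0 := by
  linarith [mul_mul_transpose_antisymm hB Q i i]

lemma trace_transpose_mul_eq_sum (A X : Matrix (Fin d) (Fin d) ℝ) :
    (Aᵀ * X).trace = ∑ i, ∑ j, A i j * X i j := by
  simp only [trace, diag, mul_apply, transpose_apply]
  exact Finset.sum_comm

lemma sum_conj_mul_conj {Q : Matrix (Fin d) (Fin d) ℝ} (hQ : Q * Qᵀ = 1)
    (B B' : Matrix (Fin d) (Fin d) ℝ) :
    ∑ i, ∑ j, (Q * B * Qᵀ) i j * (Q * B' * Qᵀ) i j = (Bᵀ * B').trace := by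
  have hQ' : Qᵀ * Q = 1 := mul_eq_one_comm.1 hQ
  have h : (Q * B * Qᵀ)ᵀ * (Q * B' * Qᵀ) = Q * (Bᵀ * B') * Qᵀ := by
    calc (Q * B * Qᵀ)ᵀ * (Q * B' * Qᵀ) = Q * Bᵀ * (Qᵀ * Q) * B' * Qᵀ := by
          simp only [transpose_mul, transpose_transpose, Matrix.mul_assoc]
      _ = Q * (Bᵀ * B') * Qᵀ := by rw [hQ']; simp only [Matrix.mul_one, Matrix.mul_assoc]
  rw [← trace_transpose_mul_eq_sum, h, trace_mul_comm, ← Matrix.mul_assoc, hQ', Matrix.one_mul]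

variable (μ : Measure (Matrix (Fin d) (Fin d) ℝ))

lemma integrable_conj_mul_conj [IsProbabilityMeasure μ]
    (hsupp : ∀ᵐ Q ∂μ, Q * Qᵀ = 1)
    (B B' : Matrix (Fin d) (Fin d) ℝ) (i j k l : Fin d) :
    Integrable (fun Q => (Q * B * Qᵀ) i j * (Q * B' * Qᵀ) k l) μ := by
  refine Integrable.of_bound ((measurable_mul_mul_transpose_entry B i j).mul
    (measurable_mul_mul_transpose_entry B' k l)).aestronglyMeasurable
    ((∑ l, ∑ k, |B k l|) * ∑ l, ∑ k, |B' k l|) ?_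
  filter_upwards [hsupp] with Q hQ
  rw [Real.norm_eq_abs, abs_mul]
  exact mul_le_mul (abs_mul_mul_transpose_entry_le hQ B i j)
    (abs_mul_mul_transpose_entry_le hQ B' k l) (abs_nonneg _) (by positivity)

/-- The second moments of the entries of `Q * B * Qᵀ` and `Q * B' * Qᵀ`. -/
noncomputable def conjMoment (B B' : Matrix (Fin d) (Fin d) ℝ) (i j k l : Fin d) : ℝ :=
  ∫ Q, (Q * B * Qᵀ) i j * (Q * B' * Qᵀ) k l ∂μ

variable {μ}

lemma conjMoment_eq_integral_mul_left
    (hinv : ∀ g : Matrix (Fin d) (Fin d) ℝ, g * gᵀ = 1 → Measure.map (fun Q => g * Q) μ = μ)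
    (B B' : Matrix (Fin d) (Fin d) ℝ) (i j k l : Fin d)
    {g : Matrix (Fin d) (Fin d) ℝ} (hg : g * gᵀ = 1) :
    conjMoment μ B B' i j k l =
      ∫ Q, (g * Q * B * (g * Q)ᵀ) i j * (g * Q * B' * (g * Q)ᵀ) k l ∂μ := by
  rw [conjMoment]
  conv_lhs => rw [← hinv g hg]
  exact integral_map (measurable_const_mul_left g).aemeasurable
    ((measurable_mul_mul_transpose_entry B i j).mul
      (measurable_mul_mul_transpose_entry B' k l)).aestronglyMeasurable

lemma conjMoment_sign
    (hinv : ∀ g : Matrix (Fin d) (Fin d) ℝ, g * gᵀ = 1 → Measure.map (fun Q => g * Q) μ = μ)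
    (B B' : Matrix (Fin d) (Fin d) ℝ) (i j k l : Fin d)
    (s : Fin d → ℝ) (hs : ∀ a, s a * s a = 1) :
    conjMoment μ B B' i j k l = s i * s j * s k * s l * conjMoment μ B B' i j k l := by
  have hg : diagonal s * (diagonal s)ᵀ = 1 := by simp [hs]
  conv_lhs => rw [conjMoment_eq_integral_mul_left hinv B B' i j k l hg]
  rw [conjMoment, ← integral_const_mul]
  congr 1 with Q
  have h (C : Matrix (Fin d) (Fin d) ℝ) (a b : Fin d) :
      (diagonal s * Q * C * (diagonal s * Q)ᵀ) a b = s a * s b * (Q * C * Qᵀ) a b := by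
    simp only [mul_mul_transpose_entry, diagonal_mul, Finset.mul_sum]
    exact Finset.sum_congr rfl fun _ _ => Finset.sum_congr rfl fun _ _ => by ring
  rw [h, h]
  ring

lemma conjMoment_perm
    (hinv : ∀ g : Matrix (Fin d) (Fin d) ℝ, g * gᵀ = 1 → Measure.map (fun Q => g * Q) μ = μ)
    (B B' : Matrix (Fin d) (Fin d) ℝ) (i j k l : Fin d) (σ : Equiv.Perm (Fin d)) :
    conjMoment μ B B' i j k l = conjMoment μ B B' (σ i) (σ j) (σ k) (σ l) := by
  have hg : (1 : Matrix (Fin d) (Fin d) ℝ).submatrix σ id *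
      ((1 : Matrix (Fin d) (Fin d) ℝ).submatrix σ id)ᵀ = 1 := by
    ext a b
    simp [mul_apply, one_apply]
  rw [conjMoment_eq_integral_mul_left hinv B B' i j k l hg, conjMoment]
  congr 1 with Q
  have h (C : Matrix (Fin d) (Fin d) ℝ) (a b : Fin d) :
      ((1 : Matrix (Fin d) (Fin d) ℝ).submatrix σ id * Q * C *
        ((1 : Matrix (Fin d) (Fin d) ℝ).submatrix σ id * Q)ᵀ) a b =
      (Q * C * Qᵀ) (σ a) (σ b) := by
    have e : (1 : Matrix (Fin d) (Fin d) ℝ).submatrix σ id * Q = Q.submatrix σ id := by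
      ext a b
      simp [mul_apply, one_apply]
    simp only [e, mul_mul_transpose_entry, submatrix_apply, id]
  rw [h, h]

lemma conjMoment_swap_right {B' : Matrix (Fin d) (Fin d) ℝ} (hB' : B'ᵀ = -B')
    (B : Matrix (Fin d) (Fin d) ℝ) (i j k l : Fin d) :
    conjMoment μ B B' i j l k = -conjMoment μ B B' i j k l := by
  rw [conjMoment, conjMoment, ← integral_neg]
  congr 1 with Q
  rw [mul_mul_transpose_antisymm hB' Q k l, mul_neg]

/-- A moment vanishes as soon as some index occurs exactly once. -/
lemma conjMoment_eq_zero
    (hinv : ∀ g : Matrix (Fin d) (Fin d) ℝ, g * gᵀ = 1 → Measure.map (fun Q => g * Q) μ = μ)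
    {B B' : Matrix (Fin d) (Fin d) ℝ} {i j k l : Fin d}
    (hij : i ≠ j) (h : (i ≠ k ∧ i ≠ l) ∨ (j ≠ k ∧ j ≠ l)) :
    conjMoment μ B B' i j k l = 0 := by
  have key (m : Fin d) := conjMoment_sign hinv B B' i j k l (fun a => if a = m then -1 else 1)
    (fun a => by split_ifs <;> norm_num)
  rcases h with ⟨h₁, h₂⟩ | ⟨h₁, h₂⟩
  · have := key i
    simp only [hij.symm, h₁.symm, h₂.symm, if_true, if_false] at this
    linarith
  · have := key j
    simp only [hij, h₁.symm, h₂.symm, if_true, if_false] at this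
    linarith

lemma exists_perm_map_pair {α : Type*} [DecidableEq α] {a b i j : α}
    (hab : a ≠ b) (hij : i ≠ j) : ∃ σ : Equiv.Perm α, σ a = i ∧ σ b = j := by
  have h : a ≠ Equiv.swap a i j := fun h => hij <| by
    have := congrArg (Equiv.swap a i) h
    simpa using this
  refine ⟨(Equiv.swap b (Equiv.swap a i j)).trans (Equiv.swap a i), ?_, ?_⟩
  · simp [Equiv.swap_apply_of_ne_of_ne hab h]
  · simp

/-- The second moments of two conjugated antisymmetric matrices are proportional to the identity
on antisymmetric matrices. -/
lemma exists_conjMoment_eq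
    (hinv : ∀ g : Matrix (Fin d) (Fin d) ℝ, g * gᵀ = 1 → Measure.map (fun Q => g * Q) μ = μ)
    (hd : 2 ≤ d) {B B' : Matrix (Fin d) (Fin d) ℝ} (hB : Bᵀ = -B) (hB' : B'ᵀ = -B') :
    ∃ c : ℝ, ∀ i j k l, conjMoment μ B B' i j k l =
      c * ((if k = i then 1 else 0) * (if l = j then 1 else 0) -
        (if l = i then 1 else 0) * (if k = j then 1 else 0)) := by
  let a : Fin d := ⟨0, by omega⟩
  let b : Fin d := ⟨1, by omega⟩
  have hab : a ≠ b := by simp [a, b]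
  have hc {i j : Fin d} (hij : i ≠ j) :
      conjMoment μ B B' i j i j = conjMoment μ B B' a b a b := by
    obtain ⟨σ, rfl, rfl⟩ := exists_perm_map_pair hab hij
    exact (conjMoment_perm hinv B B' a b a b σ).symm
  refine ⟨conjMoment μ B B' a b a b, fun i j k l => ?_⟩
  rcases eq_or_ne i j with rfl | hij
  · have : conjMoment μ B B' i i k l = 0 := by simp [conjMoment, mul_mul_transpose_diag hB]
    rw [this]
    ring
  rcases eq_or_ne k l with rfl | hkl
  · have : conjMoment μ B B' i j k k = 0 := by simp [conjMoment, mul_mul_transpose_diag hB']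
    rw [this]
    ring
  by_cases h₁ : k = i ∧ l = j
  · obtain ⟨rfl, rfl⟩ := h₁
    simp [hc hij, hij, hij.symm]
  by_cases h₂ : l = i ∧ k = j
  · obtain ⟨rfl, rfl⟩ := h₂
    rw [conjMoment_swap_right hB', hc hij]
    simp [hij, hij.symm]
  rw [conjMoment_eq_zero hinv hij (by grind)]
  have e₁ : ((if k = i then 1 else 0) * (if l = j then 1 else 0) : ℝ) = 0 := by
    grind
  have e₂ : ((if l = i then 1 else 0) * (if k = j then 1 else 0) : ℝ) = 0 := by
    grind
  rw [e₁, e₂]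
  ring

/-- The covariance of `Q ↦ Tr (Aᵀ Q B Qᵀ)` and `Q ↦ Tr (Aᵀ Q B' Qᵀ)` on `O(d)`. -/
theorem integral_trace_conj_mul_trace_conj [IsProbabilityMeasure μ] (hd : 2 ≤ d)
    (hsupp : ∀ᵐ Q ∂μ, Q * Qᵀ = 1)
    (hinv : ∀ g : Matrix (Fin d) (Fin d) ℝ, g * gᵀ = 1 → Measure.map (fun Q => g * Q) μ = μ)
    {A B B' : Matrix (Fin d) (Fin d) ℝ} (hA : Aᵀ = -A) (hB : Bᵀ = -B) (hB' : B'ᵀ = -B') :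
    ∫ Q, (Aᵀ * Q * B * Qᵀ).trace * (Aᵀ * Q * B' * Qᵀ).trace ∂μ
      = 2 * (Aᵀ * A).trace * (Bᵀ * B').trace / ((d : ℝ) * (d - 1)) := by
  have hint := integrable_conj_mul_conj μ hsupp B B'
  obtain ⟨c, hc⟩ := exists_conjMoment_eq hinv hd hB hB'
  have hsum : c * ((d : ℝ) * (d - 1)) = (Bᵀ * B').trace := by
    have h₁ : ∑ i, ∑ j, conjMoment μ B B' i j i j = (Bᵀ * B').trace := by
      have h : ∫ Q, ∑ i, ∑ j, (Q * B * Qᵀ) i j * (Q * B' * Qᵀ) i j ∂μ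
          = ∫ _, (Bᵀ * B').trace ∂μ :=
        integral_congr_ae (hsupp.mono fun Q hQ => sum_conj_mul_conj hQ B B')
      rw [integral_finsetSum _ fun i _ => integrable_finsetSum _ fun j _ => hint i j i j] at h
      simp_rw [integral_finsetSum _ fun j _ => hint _ j _ j] at h
      simpa [conjMoment] using h
    rw [← h₁]
    simp only [hc, if_true, mul_sub, Finset.sum_sub_distrib]
    simp
    ring
  have hA' (i j : Fin d) : A j i = -A i j := by simpa using congrFun₂ hA i j
  have hexp (Q : Matrix (Fin d) (Fin d) ℝ) :
      (Aᵀ * Q * B * Qᵀ).trace * (Aᵀ * Q * B' * Qᵀ).trace =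
        ∑ i, ∑ j, ∑ k, ∑ l, A i j * A k l * ((Q * B * Qᵀ) i j * (Q * B' * Qᵀ) k l) := by
    have h (C : Matrix (Fin d) (Fin d) ℝ) :
        (Aᵀ * Q * C * Qᵀ).trace = ∑ i, ∑ j, A i j * (Q * C * Qᵀ) i j := by
      rw [← trace_transpose_mul_eq_sum]
      simp only [Matrix.mul_assoc]
    rw [h, h]
    simp only [Finset.sum_mul]
    simp only [Finset.mul_sum]
    refine Finset.sum_congr rfl fun i _ => Finset.sum_congr rfl fun j _ =>
      Finset.sum_congr rfl fun k _ => Finset.sum_congr rfl fun l _ => by ring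
  have hI (i j k l : Fin d) := (hint i j k l).const_mul (A i j * A k l)
  simp_rw [hexp]
  have hmom : ∫ Q, ∑ i, ∑ j, ∑ k, ∑ l,
        A i j * A k l * ((Q * B * Qᵀ) i j * (Q * B' * Qᵀ) k l) ∂μ =
      ∑ i, ∑ j, ∑ k, ∑ l, A i j * A k l * conjMoment μ B B' i j k l := by
    rw [integral_finsetSum _ fun i _ => integrable_finsetSum _ fun j _ =>
      integrable_finsetSum _ fun k _ => integrable_finsetSum _ fun l _ => hI i j k l]
    refine Finset.sum_congr rfl fun i _ => ?_
    rw [integral_finsetSum _ fun j _ =>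
      integrable_finsetSum _ fun k _ => integrable_finsetSum _ fun l _ => hI i j k l]
    refine Finset.sum_congr rfl fun j _ => ?_
    rw [integral_finsetSum _ fun k _ => integrable_finsetSum _ fun l _ => hI i j k l]
    refine Finset.sum_congr rfl fun k _ => ?_
    rw [integral_finsetSum _ fun l _ => hI i j k l]
    exact Finset.sum_congr rfl fun l _ => integral_const_mul _ _
  have hinner (i j : Fin d) :
      ∑ k, ∑ l, A i j * A k l * conjMoment μ B B' i j k l = 2 * c * (A i j * A i j) := by
    have h : ∑ k, ∑ l, A i j * A k l * conjMoment μ B B' i j k l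
        = A i j * A i j * c - A i j * A j i * c := by
      simp [hc, mul_sub, Finset.sum_sub_distrib]
    rw [h, hA' i j]
    ring
  rw [hmom, trace_transpose_mul_eq_sum A A, ← hsum]
  simp_rw [hinner, ← Finset.mul_sum]
  have hd' : (2 : ℝ) ≤ d := by exact_mod_cast hd
  have h₁ : (d : ℝ) ≠ 0 := by positivity
  have h₂ : (d : ℝ) - 1 ≠ 0 := by linarith
  field_simp

end Matrix

/-- Let `n ≥ 1` and let `μ` be the Haar probability measure on `O(2n)`
(formalized as a Borel probability measure on `2n × 2n` real matrices concentrated on the set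
of orthogonal matrices and invariant under left translation by every orthogonal matrix).
Then for all antisymmetric real `2n × 2n` matrices `A, B, B'`,
`∫ Tr(Aᵀ Q B Qᵀ) · Tr(Aᵀ Q B' Qᵀ) dμ(Q) = Tr(Aᵀ A) · Tr(Bᵀ B') / (n(2n−1))`.
This is the exact two-Majorana (B₂) covariance. -/
theorem haar_orthogonal_B2_covariance
    (n : ℕ) (hn : 1 ≤ n)
    (μ : Measure (Matrix (Fin (2 * n)) (Fin (2 * n)) ℝ)) [IsProbabilityMeasure μ]
    (hsupp : μ {Q : Matrix (Fin (2 * n)) (Fin (2 * n)) ℝ | Q * Qᵀ = 1}ᶜ = 0)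
    (hinv : ∀ g : Matrix (Fin (2 * n)) (Fin (2 * n)) ℝ, g * gᵀ = 1 →
      Measure.map (fun Q => g * Q) μ = μ)
    (A B B' : Matrix (Fin (2 * n)) (Fin (2 * n)) ℝ)
    (hA : Aᵀ = -A) (hB : Bᵀ = -B) (hB' : B'ᵀ = -B') :
    ∫ Q, (Aᵀ * Q * B * Qᵀ).trace * (Aᵀ * Q * B' * Qᵀ).trace ∂μ
      = (Aᵀ * A).trace * (Bᵀ * B').trace / ((n : ℝ) * (2 * n - 1)) := by
  rw [integral_trace_conj_mul_trace_conj (by omega) (mem_ae_iff.2 hsupp) hinv hA hB hB']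
  have h₁ : (n : ℝ) ≠ 0 := by positivity
  have h₂ : (2 * n : ℝ) - 1 ≠ 0 := by
    have : (1 : ℝ) ≤ n := by exact_mod_cast hn
    linarith
  push_cast
  field_simp
end

section
/- Let n ≥ 1 and let μ be the Haar probability measure on O(2n). Writing S(Q) = Q J Qᵀ, for all indices μ', ν', α', β' ∈ {1,…,2n} one has ∫_{O(2n)} S(Q)_{μ'ν'} · S(Q)_{α'β'} dμ(Q) = (δ_{μ'α'} δ_{ν'β'} − δ_{μ'β'} δ_{ν'α'}) / (2n−1). In particular ∫ (Tr(Jᵀ Q J Qᵀ))² dμ(Q) = 4n/(2n−1), so the variance of the B₂ frame-coefficient overlap of two independent Haar-random Gaussian states equals n/((2n−1)·4ⁿ). -/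
open MeasureTheory Matrix

/-- The `2n × 2n` symplectic identity `J`: block diagonal with `n` copies of the `2 × 2`
block `[[0,1],[-1,0]]`. -/
def symplJ (n : ℕ) : Matrix (Fin (2 * n)) (Fin (2 * n)) ℝ :=
  Matrix.of fun i j =>
    if (i : ℕ) % 2 = 0 ∧ (j : ℕ) = (i : ℕ) + 1 then 1
    else if (j : ℕ) % 2 = 0 ∧ (i : ℕ) = (j : ℕ) + 1 then -1
    else 0

namespace Matrix

/-- The monomial matrix attached to a permutation `σ` and a vector `e` of coefficients. -/
def monomial {d : ℕ} (σ : Equiv.Perm (Fin d)) (e : Fin d → ℝ) : Matrix (Fin d) (Fin d) ℝ :=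
  Matrix.of fun i j => if j = σ i then e i else 0

theorem monomial_mul_apply {d : ℕ} (σ : Equiv.Perm (Fin d)) (e : Fin d → ℝ)
    (A : Matrix (Fin d) (Fin d) ℝ) (i j : Fin d) :
    (monomial σ e * A) i j = e i * A (σ i) j := by
  simp [monomial, mul_apply]

theorem mul_monomial_transpose_apply {d : ℕ} (σ : Equiv.Perm (Fin d)) (e : Fin d → ℝ)
    (A : Matrix (Fin d) (Fin d) ℝ) (i j : Fin d) :
    (A * (monomial σ e)ᵀ) i j = e j * A i (σ j) := by
  simp [monomial, mul_apply, mul_comm]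

theorem monomial_mul_transpose_self {d : ℕ} (σ : Equiv.Perm (Fin d)) (e : Fin d → ℝ)
    (he : ∀ i, e i * e i = 1) : monomial σ e * (monomial σ e)ᵀ = 1 := by
  ext i j
  rw [monomial_mul_apply, transpose_apply]
  by_cases h : i = j
  · subst h
    simp [monomial, he]
  · simp [monomial, h]

theorem conj_monomial_mul_apply {d : ℕ} (σ : Equiv.Perm (Fin d)) (e : Fin d → ℝ)
    (J Q : Matrix (Fin d) (Fin d) ℝ) (i j : Fin d) :
    ((monomial σ e * Q) * J * (monomial σ e * Q)ᵀ) i j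
      = e i * e j * (Q * J * Qᵀ) (σ i) (σ j) := by
  have h : (monomial σ e * Q) * J * (monomial σ e * Q)ᵀ
      = (monomial σ e * (Q * J * Qᵀ)) * (monomial σ e)ᵀ := by
    simp only [transpose_mul, Matrix.mul_assoc]
  rw [h, mul_monomial_transpose_apply, monomial_mul_apply]
  ring

theorem conj_apply_swap {d : ℕ} {J : Matrix (Fin d) (Fin d) ℝ} (hJ : Jᵀ = -J)
    (Q : Matrix (Fin d) (Fin d) ℝ) (i j : Fin d) :
    (Q * J * Qᵀ) j i = -(Q * J * Qᵀ) i j := by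
  have h : (Q * J * Qᵀ)ᵀ = -(Q * J * Qᵀ) := by
    simp [transpose_mul, hJ, Matrix.mul_assoc]
  simpa using congrFun (congrFun h i) j

theorem conj_apply_self {d : ℕ} {J : Matrix (Fin d) (Fin d) ℝ} (hJ : Jᵀ = -J)
    (Q : Matrix (Fin d) (Fin d) ℝ) (i : Fin d) : (Q * J * Qᵀ) i i = 0 := by
  have := conj_apply_swap hJ Q i i
  linarith

theorem sum_conj_apply_mul_self {d : ℕ} {J : Matrix (Fin d) (Fin d) ℝ} (hJ : J * Jᵀ = 1)
    {Q : Matrix (Fin d) (Fin d) ℝ} (hQ : Q * Qᵀ = 1) (i : Fin d) :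
    ∑ j, (Q * J * Qᵀ) i j * (Q * J * Qᵀ) i j = 1 := by
  have hQ' : Qᵀ * Q = 1 := mul_eq_one_comm.mp hQ
  have h : (Q * J * Qᵀ) * (Q * J * Qᵀ)ᵀ = 1 := by
    calc (Q * J * Qᵀ) * (Q * J * Qᵀ)ᵀ = Q * (J * (Qᵀ * Q) * Jᵀ) * Qᵀ := by
          simp only [transpose_mul, transpose_transpose, Matrix.mul_assoc]
      _ = 1 := by rw [hQ', Matrix.mul_one, hJ, Matrix.mul_one, hQ]
  have h' := congrFun (congrFun h i) i
  rw [mul_apply, one_apply_eq] at h'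
  exact h'

theorem abs_conj_apply_le_one {d : ℕ} {J : Matrix (Fin d) (Fin d) ℝ} (hJ : J * Jᵀ = 1)
    {Q : Matrix (Fin d) (Fin d) ℝ} (hQ : Q * Qᵀ = 1) (i j : Fin d) :
    |(Q * J * Qᵀ) i j| ≤ 1 := by
  rw [abs_le_one_iff_mul_self_le_one, ← sum_conj_apply_mul_self hJ hQ i]
  exact Finset.single_le_sum (f := fun j => (Q * J * Qᵀ) i j * (Q * J * Qᵀ) i j)
    (fun _ _ => mul_self_nonneg _) (Finset.mem_univ j)

theorem measurable_entry {d : ℕ} (i j : Fin d) :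
    Measurable fun Q : Matrix (Fin d) (Fin d) ℝ => Q i j :=
  (measurable_pi_apply j).comp (measurable_pi_apply (X := fun _ : Fin d => Fin d → ℝ) i)

theorem measurable_conj_apply {d : ℕ} (J : Matrix (Fin d) (Fin d) ℝ) (i j : Fin d) :
    Measurable fun Q : Matrix (Fin d) (Fin d) ℝ => (Q * J * Qᵀ) i j := by
  simp only [mul_apply, transpose_apply]
  exact Finset.measurable_sum _ fun b _ =>
    (Finset.measurable_sum _ fun a _ => (measurable_entry i a).mul_const _).mul
      (measurable_entry j b)

theorem measurable_const_mul {d : ℕ} (g : Matrix (Fin d) (Fin d) ℝ) :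
    Measurable fun Q : Matrix (Fin d) (Fin d) ℝ => g * Q := by
  refine measurable_pi_lambda (X := fun _ : Fin d => Fin d → ℝ) _ fun i =>
    measurable_pi_lambda _ fun j => ?_
  simp only [mul_apply]
  exact Finset.measurable_sum _ fun a _ => (measurable_entry a j).const_mul _

end Matrix

section SecondMoments

variable {d : ℕ} {μ : Measure (Matrix (Fin d) (Fin d) ℝ)} {J : Matrix (Fin d) (Fin d) ℝ}

theorem integrable_conj_mul_conj [IsProbabilityMeasure μ]
    (hμ : ∀ᵐ Q ∂μ, Q * Qᵀ = 1) (hJ : J * Jᵀ = 1) (i j k l : Fin d) :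
    Integrable (fun Q => (Q * J * Qᵀ) i j * (Q * J * Qᵀ) k l) μ := by
  refine Integrable.of_bound
    ((measurable_conj_apply J i j).mul (measurable_conj_apply J k l)).aestronglyMeasurable 1 ?_
  filter_upwards [hμ] with Q hQ
  rw [Real.norm_eq_abs, abs_mul]
  exact mul_le_one₀ (abs_conj_apply_le_one hJ hQ i j) (abs_nonneg _)
    (abs_conj_apply_le_one hJ hQ k l)

theorem integral_conj_mul_conj_monomial
    (hinv : ∀ g : Matrix (Fin d) (Fin d) ℝ, g * gᵀ = 1 → Measure.map (fun Q => g * Q) μ = μ)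
    (σ : Equiv.Perm (Fin d)) (e : Fin d → ℝ) (he : ∀ i, e i * e i = 1) (i j k l : Fin d) :
    ∫ Q, (Q * J * Qᵀ) i j * (Q * J * Qᵀ) k l ∂μ
      = e i * e j * (e k * e l)
        * ∫ Q, (Q * J * Qᵀ) (σ i) (σ j) * (Q * J * Qᵀ) (σ k) (σ l) ∂μ := by
  conv_lhs => rw [← hinv _ (monomial_mul_transpose_self σ e he)]
  rw [← integral_const_mul]
  refine (integral_map (measurable_const_mul (monomial σ e)).aemeasurable
    ((measurable_conj_apply J i j).mul
      (measurable_conj_apply J k l)).aestronglyMeasurable).trans ?_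
  refine integral_congr_ae (.of_forall fun Q => ?_)
  simp only [Pi.mul_apply, conj_monomial_mul_apply]
  ring

theorem integral_conj_mul_conj_eq_zero
    (hinv : ∀ g : Matrix (Fin d) (Fin d) ℝ, g * gᵀ = 1 → Measure.map (fun Q => g * Q) μ = μ)
    {i j k l : Fin d} (hij : i ≠ j) (hik : i ≠ k) (hil : i ≠ l) :
    ∫ Q, (Q * J * Qᵀ) i j * (Q * J * Qᵀ) k l ∂μ = 0 := by
  have h := integral_conj_mul_conj_monomial (J := J) hinv 1 (fun a => if a = i then -1 else 1)
    (fun a => by split_ifs <;> norm_num) i j k l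
  simp only [if_true, hij.symm, hik.symm, hil.symm, if_false, Equiv.Perm.coe_one, id] at h
  linarith

theorem integral_conj_mul_self [IsProbabilityMeasure μ]
    (hμ : ∀ᵐ Q ∂μ, Q * Qᵀ = 1)
    (hinv : ∀ g : Matrix (Fin d) (Fin d) ℝ, g * gᵀ = 1 → Measure.map (fun Q => g * Q) μ = μ)
    (hJ : Jᵀ = -J) (hJ1 : J * Jᵀ = 1) {i j : Fin d} (hij : i ≠ j) :
    ((d : ℝ) - 1) * ∫ Q, (Q * J * Qᵀ) i j * (Q * J * Qᵀ) i j ∂μ = 1 := by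
  have hsum : ∑ k, ∫ Q, (Q * J * Qᵀ) i k * (Q * J * Qᵀ) i k ∂μ = 1 := by
    rw [← integral_finsetSum _ fun k _ => integrable_conj_mul_conj hμ hJ1 i k i k,
      integral_congr_ae (g := fun _ => (1 : ℝ))
        (hμ.mono fun Q hQ => sum_conj_apply_mul_self hJ1 hQ i)]
    simp
  have hdiag : ∫ Q, (Q * J * Qᵀ) i i * (Q * J * Qᵀ) i i ∂μ = 0 := by
    simp [conj_apply_self hJ]
  have hoff : ∀ k ∈ Finset.univ.erase i,
      ∫ Q, (Q * J * Qᵀ) i k * (Q * J * Qᵀ) i k ∂μ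
        = ∫ Q, (Q * J * Qᵀ) i j * (Q * J * Qᵀ) i j ∂μ := by
    intro k hk
    have hki : k ≠ i := Finset.ne_of_mem_erase hk
    have h := integral_conj_mul_conj_monomial (J := J) hinv (Equiv.swap k j) (fun _ => 1)
      (fun _ => one_mul 1) i k i k
    simpa [Equiv.swap_apply_of_ne_of_ne hki.symm hij] using h
  rw [← Finset.add_sum_erase _ _ (Finset.mem_univ i), hdiag, zero_add,
    Finset.sum_congr rfl hoff, Finset.sum_const, Finset.card_erase_of_mem (Finset.mem_univ i),
    Finset.card_univ, Fintype.card_fin, nsmul_eq_mul,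
    Nat.cast_sub (Nat.one_le_iff_ne_zero.mpr i.pos.ne'), Nat.cast_one] at hsum
  exact hsum

/-- Second moments of `Q J Qᵀ` for Haar-distributed orthogonal `Q` and `J` an orthogonal
antisymmetric matrix. -/
theorem integral_conj_mul_conj [IsProbabilityMeasure μ]
    (hμ : ∀ᵐ Q ∂μ, Q * Qᵀ = 1)
    (hinv : ∀ g : Matrix (Fin d) (Fin d) ℝ, g * gᵀ = 1 → Measure.map (fun Q => g * Q) μ = μ)
    (hJ : Jᵀ = -J) (hJ1 : J * Jᵀ = 1) (i j k l : Fin d) :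
    ∫ Q, (Q * J * Qᵀ) i j * (Q * J * Qᵀ) k l ∂μ
      = ((if i = k then (1 : ℝ) else 0) * (if j = l then 1 else 0)
          - (if i = l then (1 : ℝ) else 0) * (if j = k then 1 else 0)) / (d - 1) := by
  by_cases hij : i = j
  · subst hij
    simp [conj_apply_self hJ, mul_comm]
  by_cases hkl : k = l
  · subst hkl
    simp [conj_apply_self hJ]
  have hsq := integral_conj_mul_self hμ hinv hJ hJ1 hij
  have hd : (d : ℝ) - 1 ≠ 0 := left_ne_zero_of_mul_eq_one hsq
  by_cases hik : i = k
  · subst hik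
    by_cases hjl : j = l
    · subst hjl
      rw [eq_div_iff hd, mul_comm, hsq]
      simp [hij]
    · have h := integral_conj_mul_conj_eq_zero (J := J) hinv (Ne.symm hij) (Ne.symm hij) hjl
      simp only [conj_apply_swap hJ _ i j, neg_mul, integral_neg, neg_eq_zero] at h
      simp [h, hjl, hkl]
  · by_cases hil : i = l
    · subst hil
      by_cases hjk : j = k
      · subst hjk
        simp only [conj_apply_swap hJ _ i j, mul_neg, integral_neg]
        rw [eq_div_iff hd, neg_mul, mul_comm, hsq]
        simp [hij]
      · have h := integral_conj_mul_conj_eq_zero (J := J) hinv (Ne.symm hij) hjk (Ne.symm hij)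
        simp only [conj_apply_swap hJ _ i j, neg_mul, integral_neg, neg_eq_zero] at h
        simp [h, hik, hjk]
    · simp [integral_conj_mul_conj_eq_zero (J := J) hinv hij hik hil, hik, hil]

theorem integral_trace_transpose_mul_conj_sq [IsProbabilityMeasure μ]
    (hμ : ∀ᵐ Q ∂μ, Q * Qᵀ = 1)
    (hinv : ∀ g : Matrix (Fin d) (Fin d) ℝ, g * gᵀ = 1 → Measure.map (fun Q => g * Q) μ = μ)
    (hJ : Jᵀ = -J) (hJ1 : J * Jᵀ = 1) :
    ∫ Q, (Jᵀ * Q * J * Qᵀ).trace ^ 2 ∂μ = 2 * d / (d - 1) := by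
  have hexp : ∀ Q : Matrix (Fin d) (Fin d) ℝ, (Jᵀ * Q * J * Qᵀ).trace ^ 2
      = ∑ i, ∑ j, ∑ k, ∑ l, J i j * J k l * ((Q * J * Qᵀ) i j * (Q * J * Qᵀ) k l) := by
    intro Q
    have htr : (Jᵀ * Q * J * Qᵀ).trace = ∑ i, ∑ j, J i j * (Q * J * Qᵀ) i j := by
      rw [Matrix.mul_assoc, Matrix.mul_assoc, ← Matrix.mul_assoc Q, trace, Finset.sum_comm]
      simp only [diag_apply, mul_apply (M := Jᵀ), transpose_apply]
    rw [htr, sq]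
    simp only [Finset.sum_mul, Finset.mul_sum]
    refine Finset.sum_congr rfl fun i _ => Finset.sum_congr rfl fun j _ =>
      Finset.sum_congr rfl fun k _ => Finset.sum_congr rfl fun l _ => ?_
    ring
  have hint : ∀ i j k l, Integrable
      (fun Q => J i j * J k l * ((Q * J * Qᵀ) i j * (Q * J * Qᵀ) k l)) μ := fun i j k l =>
    (integrable_conj_mul_conj hμ hJ1 i j k l).const_mul _
  have hJsq : ∑ i, ∑ j, J i j * J i j = d := by
    have h := congrArg trace hJ1
    simpa [trace, mul_apply] using h
  have hJswap : ∀ i j, J j i = -J i j := fun i j => by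
    simpa using congrFun (congrFun hJ i) j
  simp only [hexp]
  rw [integral_finsetSum _ fun i _ => integrable_finsetSum _ fun j _ =>
    integrable_finsetSum _ fun k _ => integrable_finsetSum _ fun l _ => hint i j k l]
  have hinner : ∀ i j, ∫ Q, ∑ k, ∑ l, J i j * J k l *
      ((Q * J * Qᵀ) i j * (Q * J * Qᵀ) k l) ∂μ = J i j * J i j * (2 / (d - 1)) := by
    intro i j
    rw [integral_finsetSum _ fun k _ => integrable_finsetSum _ fun l _ => hint i j k l]
    simp_rw [integral_finsetSum Finset.univ fun l _ => hint i j _ l, integral_const_mul,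
      integral_conj_mul_conj hμ hinv hJ hJ1, sub_div, mul_sub, Finset.sum_sub_distrib]
    simp [ite_div, hJswap i j]
    ring
  simp_rw [integral_finsetSum Finset.univ fun j _ => integrable_finsetSum Finset.univ fun k _ =>
    integrable_finsetSum Finset.univ fun l _ => hint _ j k l, hinner, ← Finset.sum_mul, hJsq]
  ring

end SecondMoments

theorem symplJ_transpose (n : ℕ) : (symplJ n)ᵀ = -symplJ n := by
  ext i j
  rw [transpose_apply, neg_apply]
  simp only [symplJ, of_apply]
  split_ifs <;> first | omega | norm_num

theorem symplJ_mul_transpose (n : ℕ) : symplJ n * (symplJ n)ᵀ = 1 := by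
  ext i j
  rw [mul_apply, one_apply]
  have hlt : (if (i : ℕ) % 2 = 0 then (i : ℕ) + 1 else i - 1) < 2 * n := by
    have := i.isLt
    split_ifs <;> omega
  obtain ⟨p, hp⟩ : ∃ p : Fin (2 * n), (p : ℕ) = if (i : ℕ) % 2 = 0 then (i : ℕ) + 1 else i - 1 :=
    ⟨⟨_, hlt⟩, rfl⟩
  rw [Finset.sum_eq_single p]
  · simp only [symplJ, transpose_apply, of_apply, Fin.ext_iff]
    split_ifs at * <;> first | omega | norm_num
  · intro b _ hb
    have hb' : (b : ℕ) ≠ p := fun h => hb (Fin.ext h)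
    have h0 : symplJ n i b = 0 := by
      simp only [symplJ, of_apply]
      split_ifs at * <;> first | omega | rfl
    rw [h0, zero_mul]
  · simp

/-- Let `n ≥ 1` and `μ` the Haar probability measure on `O(2n)` (formalized
as a Borel probability measure on `2n × 2n` real matrices concentrated on the orthogonal
matrices and invariant under left translation by every orthogonal matrix).  Writing
`S(Q) = Q J Qᵀ`, for all indices `μ', ν', α', β'` one has
`∫ S(Q)_{μ'ν'} S(Q)_{α'β'} dμ(Q) = (δ_{μ'α'} δ_{ν'β'} − δ_{μ'β'} δ_{ν'α'}) / (2n−1)`.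
In particular `∫ (Tr(Jᵀ Q J Qᵀ))² dμ(Q) = 4n/(2n−1)`, so the variance of the B₂
frame-coefficient overlap `(2·2ⁿ)⁻¹ Tr(Jᵀ Q J Qᵀ)` of two independent Haar-random Gaussian
states equals `n/((2n−1)·4ⁿ)`. -/
theorem haar_orthogonal_symplectic_second_moments
    (n : ℕ) (hn : 1 ≤ n)
    (μ : Measure (Matrix (Fin (2 * n)) (Fin (2 * n)) ℝ)) [IsProbabilityMeasure μ]
    (hsupp : μ {Q : Matrix (Fin (2 * n)) (Fin (2 * n)) ℝ | Q * Qᵀ = 1}ᶜ = 0)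
    (hinv : ∀ g : Matrix (Fin (2 * n)) (Fin (2 * n)) ℝ, g * gᵀ = 1 →
      Measure.map (fun Q => g * Q) μ = μ) :
    (∀ μ' ν' α' β' : Fin (2 * n),
      ∫ Q, (Q * symplJ n * Qᵀ) μ' ν' * (Q * symplJ n * Qᵀ) α' β' ∂μ
        = ((if μ' = α' then (1 : ℝ) else 0) * (if ν' = β' then 1 else 0)
            - (if μ' = β' then (1 : ℝ) else 0) * (if ν' = α' then 1 else 0)) / (2 * n - 1))
    ∧ (∫ Q, ((symplJ n)ᵀ * Q * symplJ n * Qᵀ).trace ^ 2 ∂μ = 4 * n / (2 * n - 1))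
    ∧ (∫ Q, (((2 * 2 ^ n : ℝ))⁻¹ * ((symplJ n)ᵀ * Q * symplJ n * Qᵀ).trace) ^ 2 ∂μ
        = n / ((2 * n - 1) * 4 ^ n)) := by
  have hae : ∀ᵐ Q ∂μ, Q * Qᵀ = 1 := hsupp
  have htrace : ∫ Q, ((symplJ n)ᵀ * Q * symplJ n * Qᵀ).trace ^ 2 ∂μ = 4 * n / (2 * n - 1) := by
    rw [integral_trace_transpose_mul_conj_sq hae hinv (symplJ_transpose n)
      (symplJ_mul_transpose n)]
    push_cast
    ring
  refine ⟨fun i j k l => ?_, htrace, ?_⟩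
  · rw [integral_conj_mul_conj hae hinv (symplJ_transpose n) (symplJ_mul_transpose n)]
    push_cast
    rfl
  · have hn' : (1 : ℝ) ≤ n := by exact_mod_cast hn
    have hd : (2 * n - 1 : ℝ) ≠ 0 := by linarith
    have h4 : (4 : ℝ) ^ n = (2 ^ n) ^ 2 := by rw [← pow_mul, mul_comm, pow_mul]; norm_num
    simp only [mul_pow]
    rw [integral_const_mul, htrace, h4]
    field_simp
    norm_num
end

section
/- The matrix M is symmetric (Mᵀ = M) and satisfies M·M·M = 4·M and Tr(M·M) = 24. Consequently (1/4)·M² is an orthogonal projection matrix of rank 6 (the projector onto the span of the six 2-forms e_a∧e_b, e_a∧e_c, e_a∧e_d, e_b∧e_c, e_b∧e_d, e_c∧e_d). -/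
open Matrix

/-- `ε^{pq}`: the `N × N` real matrix with entries `ε^{pq}_{ij} = δ_{ip}δ_{jq} − δ_{iq}δ_{jp}`. -/
def eps {N : ℕ} (p q : Fin N) : Matrix (Fin N) (Fin N) ℝ :=
  Matrix.of fun i j =>
    (if i = p then (1 : ℝ) else 0) * (if j = q then 1 else 0)
      - (if i = q then (1 : ℝ) else 0) * (if j = p then 1 else 0)

/-- The matrix reshaping `M` of the `B₄` frame-coefficient tensor of the Pauli observable
`−C_a C_b C_c C_d`, with rows and columns indexed by pairs `(i,j)`. -/
def Mmat {N : ℕ} (a b c d : Fin N) :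
    Matrix (Fin N × Fin N) (Fin N × Fin N) ℝ :=
  Matrix.of fun ij kl =>
    eps a b ij.1 ij.2 * eps c d kl.1 kl.2
      - eps a c ij.1 ij.2 * eps b d kl.1 kl.2
      + eps a d ij.1 ij.2 * eps b c kl.1 kl.2
      + eps c d ij.1 ij.2 * eps a b kl.1 kl.2
      - eps b d ij.1 ij.2 * eps a c kl.1 kl.2
      + eps b c ij.1 ij.2 * eps a d kl.1 kl.2

/-- The entrywise inner product of `ε^{pq}` and `ε^{rs}`. -/
theorem sum_eps_mul_eps {N : ℕ} (p q r s : Fin N) :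
    ∑ x : Fin N × Fin N, eps p q x.1 x.2 * eps r s x.1 x.2
      = 2 * ((if p = r then 1 else 0) * (if q = s then 1 else 0)
        - (if p = s then 1 else 0) * (if q = r then 1 else 0)) := by
  have delta_sum (u v : Fin N) :
      ∑ i : Fin N, (if i = u then (1 : ℝ) else 0) * (if i = v then 1 else 0)
        = if u = v then 1 else 0 := by simp [eq_comm]
  have prod_sum (u v w z : Fin N) :
      ∑ i : Fin N, ∑ j : Fin N,
          ((if i = u then (1 : ℝ) else 0) * (if i = v then 1 else 0))
            * ((if j = w then 1 else 0) * (if j = z then 1 else 0))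
        = (if u = v then 1 else 0) * (if w = z then 1 else 0) := by
    rw [← Finset.sum_mul_sum, delta_sum, delta_sum]
  rw [Fintype.sum_prod_type]
  calc
    _ = ∑ i : Fin N, ∑ j : Fin N,
          (((if i = p then (1 : ℝ) else 0) * (if i = r then 1 else 0))
              * ((if j = q then 1 else 0) * (if j = s then 1 else 0))
            - ((if i = p then (1 : ℝ) else 0) * (if i = s then 1 else 0))
              * ((if j = q then 1 else 0) * (if j = r then 1 else 0))
            - ((if i = q then (1 : ℝ) else 0) * (if i = r then 1 else 0))
              * ((if j = p then 1 else 0) * (if j = s then 1 else 0))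
            + ((if i = q then (1 : ℝ) else 0) * (if i = s then 1 else 0))
              * ((if j = p then 1 else 0) * (if j = r then 1 else 0))) := by
      refine Finset.sum_congr rfl fun i _ => Finset.sum_congr rfl fun j _ => ?_
      simp only [eps, of_apply]
      ring
    _ = _ := by
      simp only [Finset.sum_add_distrib, Finset.sum_sub_distrib, prod_sum]
      ring

/-- The matrix whose columns are `ε^{ab}, ε^{ac}, ε^{ad}, ε^{bc}, ε^{bd}, ε^{cd}`. -/
def epsColumns {N : ℕ} (a b c d : Fin N) : Matrix (Fin N × Fin N) (Fin 6) ℝ :=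
  of fun x k => eps (![a, a, a, b, b, c] k) (![b, c, d, c, d, d] k) x.1 x.2

/-- The signed permutation matrix of the Hodge star on the 2-forms in four dimensions. -/
def hodgeSign : Matrix (Fin 6) (Fin 6) ℝ :=
  !![0, 0, 0, 0, 0, 1;
     0, 0, 0, 0, -1, 0;
     0, 0, 0, 1, 0, 0;
     0, 0, 1, 0, 0, 0;
     0, -1, 0, 0, 0, 0;
     1, 0, 0, 0, 0, 0]

theorem hodgeSign_transpose : hodgeSignᵀ = hodgeSign := by
  ext i j
  fin_cases i <;> fin_cases j <;> simp [hodgeSign]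

theorem hodgeSign_mul_self : hodgeSign * hodgeSign = 1 := by
  ext i j
  fin_cases i <;> fin_cases j <;> simp [hodgeSign, mul_apply, Fin.sum_univ_succ]

theorem Mmat_eq_mul {N : ℕ} (a b c d : Fin N) :
    Mmat a b c d = epsColumns a b c d * hodgeSign * (epsColumns a b c d)ᵀ := by
  ext x y
  simp [Mmat, epsColumns, hodgeSign, mul_apply, Fin.sum_univ_succ]
  ring

theorem epsColumns_transpose_mul_self {N : ℕ} {a b c d : Fin N}
    (hab : a ≠ b) (hac : a ≠ c) (had : a ≠ d)
    (hbc : b ≠ c) (hbd : b ≠ d) (hcd : c ≠ d) :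
    (epsColumns a b c d)ᵀ * epsColumns a b c d = (2 : ℝ) • 1 := by
  ext i j
  refine (sum_eps_mul_eps _ _ _ _).trans ?_
  fin_cases i <;> fin_cases j <;>
    simp [hab, hac, had, hbc, hbd, hcd, hab.symm, hac.symm, had.symm, hbc.symm, hbd.symm, hcd.symm]

theorem Mmat_transpose {N : ℕ} (a b c d : Fin N) : (Mmat a b c d)ᵀ = Mmat a b c d := by
  simp only [Mmat_eq_mul, transpose_mul, transpose_transpose, hodgeSign_transpose,
    Matrix.mul_assoc]

theorem Mmat_mul_self {N : ℕ} {a b c d : Fin N}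
    (hab : a ≠ b) (hac : a ≠ c) (had : a ≠ d)
    (hbc : b ≠ c) (hbd : b ≠ d) (hcd : c ≠ d) :
    Mmat a b c d * Mmat a b c d
      = (2 : ℝ) • (epsColumns a b c d * (epsColumns a b c d)ᵀ) := by
  have hU := epsColumns_transpose_mul_self hab hac had hbc hbd hcd
  rw [Mmat_eq_mul]
  generalize epsColumns a b c d = U at hU ⊢
  calc
    _ = U * hodgeSign * (Uᵀ * U) * hodgeSign * Uᵀ := by simp only [Matrix.mul_assoc]
    _ = (2 : ℝ) • (U * (hodgeSign * hodgeSign) * Uᵀ) := by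
      rw [hU]
      simp only [Matrix.mul_smul, Matrix.smul_mul, Matrix.mul_one, Matrix.mul_assoc]
    _ = _ := by rw [hodgeSign_mul_self, Matrix.mul_one]

theorem Mmat_cube {N : ℕ} {a b c d : Fin N}
    (hab : a ≠ b) (hac : a ≠ c) (had : a ≠ d)
    (hbc : b ≠ c) (hbd : b ≠ d) (hcd : c ≠ d) :
    Mmat a b c d * Mmat a b c d * Mmat a b c d = (4 : ℝ) • Mmat a b c d := by
  have hU := epsColumns_transpose_mul_self hab hac had hbc hbd hcd
  rw [Mmat_mul_self hab hac had hbc hbd hcd, Mmat_eq_mul]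
  generalize epsColumns a b c d = U at hU ⊢
  calc
    _ = (2 : ℝ) • (U * (Uᵀ * U) * hodgeSign * Uᵀ) := by
      simp only [Matrix.smul_mul, Matrix.mul_assoc]
    _ = _ := by
      rw [hU, Matrix.mul_smul, Matrix.mul_one, Matrix.smul_mul, Matrix.smul_mul, smul_smul]
      norm_num

/-- Fix `n` with `2n ≥ 4` and pairwise distinct indices `a, b, c, d`.
The matrix `M` is symmetric (`Mᵀ = M`) and satisfies `M·M·M = 4·M` and `Tr(M·M) = 24`.
Consequently `(1/4)·M²` is an orthogonal projection matrix of rank `6`. -/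
theorem Mmat_symm_cube_trace (n : ℕ) (hn : 4 ≤ 2 * n)
    (a b c d : Fin (2 * n))
    (hab : a ≠ b) (hac : a ≠ c) (had : a ≠ d)
    (hbc : b ≠ c) (hbd : b ≠ d) (hcd : c ≠ d) :
    (Mmat a b c d)ᵀ = Mmat a b c d
    ∧ Mmat a b c d * Mmat a b c d * Mmat a b c d = (4 : ℝ) • Mmat a b c d
    ∧ (Mmat a b c d * Mmat a b c d).trace = 24
    ∧ ((1 / 4 : ℝ) • (Mmat a b c d * Mmat a b c d))
        * ((1 / 4 : ℝ) • (Mmat a b c d * Mmat a b c d))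
        = (1 / 4 : ℝ) • (Mmat a b c d * Mmat a b c d)
    ∧ ((1 / 4 : ℝ) • (Mmat a b c d * Mmat a b c d))ᵀ
        = (1 / 4 : ℝ) • (Mmat a b c d * Mmat a b c d)
    ∧ ((1 / 4 : ℝ) • (Mmat a b c d * Mmat a b c d)).rank = 6 := by
  have hU := epsColumns_transpose_mul_self hab hac had hbc hbd hcd
  have hsq := Mmat_mul_self hab hac had hbc hbd hcd
  have hcube := Mmat_cube hab hac had hbc hbd hcd
  refine ⟨Mmat_transpose a b c d, hcube, ?_, ?_, ?_, ?_⟩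
  · rw [hsq, trace_smul, trace_mul_comm, hU, trace_smul, trace_one]
    norm_num
  · rw [Matrix.smul_mul, Matrix.mul_smul, ← Matrix.mul_assoc, hcube, Matrix.smul_mul, smul_smul,
      smul_smul]
    norm_num
  · rw [transpose_smul, transpose_mul, Mmat_transpose]
  · rw [hsq, smul_smul, rank_smul_of_mem_nonZeroDivisors _ (by norm_num), rank_self_mul_transpose,
      ← rank_transpose_mul_self, hU, rank_smul_of_mem_nonZeroDivisors _ (by norm_num), rank_one,
      Fintype.card_fin]
end

section
/- The matrix M satisfies 6·Tr(M⁴) = (Tr(M²))². (This is the paper's exact Schatten-norm ratio (‖M²‖₂/‖M²‖₁)² = 1/6 for a Pauli observable in the module B₄, a constant independent of n, which shows that Pauli observables in B₄ alone cannot lead to Gaussian processes.) -/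
open Matrix

/-- The matrix whose columns are the flattened `ε^{pq}`, for the six pairs from `a, b, c, d`. -/
def epsCols {N : ℕ} (a b c d : Fin N) : Matrix (Fin N × Fin N) (Fin 6) ℝ :=
  Matrix.of fun x => ![eps a b x.1 x.2, eps a c x.1 x.2, eps a d x.1 x.2,
    eps c d x.1 x.2, eps b d x.1 x.2, eps b c x.1 x.2]

/-- The signed permutation matrix exchanging complementary pairs. -/
def pairSwap : Matrix (Fin 6) (Fin 6) ℝ :=
  !![0, 0, 0, 1, 0, 0; 0, 0, 0, 0, -1, 0; 0, 0, 0, 0, 0, 1;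
    1, 0, 0, 0, 0, 0; 0, -1, 0, 0, 0, 0; 0, 0, 1, 0, 0, 0]

theorem pairSwap_mul_self : pairSwap * pairSwap = 1 := by
  ext i j
  fin_cases i <;> fin_cases j <;> simp [pairSwap, Matrix.mul_apply, Fin.sum_univ_six]

theorem Mmat_eq_epsCols {N : ℕ} (a b c d : Fin N) :
    Mmat a b c d = epsCols a b c d * pairSwap * (epsCols a b c d)ᵀ := by
  ext x y
  simp [Mmat, epsCols, pairSwap, Matrix.mul_apply, Fin.sum_univ_six]
  ring

theorem epsCols_transpose_mul_self {N : ℕ} {a b c d : Fin N}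
    (hab : a ≠ b) (hac : a ≠ c) (had : a ≠ d) (hbc : b ≠ c) (hbd : b ≠ d) (hcd : c ≠ d) :
    (epsCols a b c d)ᵀ * epsCols a b c d = (2 : ℝ) • 1 := by
  ext i j
  rw [Matrix.mul_apply]
  fin_cases i <;> fin_cases j <;>
    simp [epsCols, sum_eps_mul_eps, hab, hac, had, hbc, hbd, hcd,
      hab.symm, hac.symm, had.symm, hbc.symm, hbd.symm, hcd.symm]

/-- Fix `n` with `2n ≥ 4` and pairwise distinct indices `a, b, c, d`.
The matrix `M` satisfies `6·Tr(M⁴) = (Tr(M²))²`.  (This is the exact Schatten-norm ratio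
`(‖M²‖₂/‖M²‖₁)² = 1/6` for a Pauli observable in the module `B₄`, a constant independent of
`n`, which shows that Pauli observables in `B₄` alone cannot lead to Gaussian processes.) -/
theorem Mmat_schatten_ratio (n : ℕ) (hn : 4 ≤ 2 * n)
    (a b c d : Fin (2 * n))
    (hab : a ≠ b) (hac : a ≠ c) (had : a ≠ d)
    (hbc : b ≠ c) (hbd : b ≠ d) (hcd : c ≠ d) :
    6 * (Mmat a b c d * Mmat a b c d * Mmat a b c d * Mmat a b c d).trace
      = ((Mmat a b c d * Mmat a b c d).trace) ^ 2 := by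
  have hU := epsCols_transpose_mul_self hab hac had hbc hbd hcd
  rw [Mmat_eq_epsCols]
  set U := epsCols a b c d
  have hsq : U * pairSwap * Uᵀ * (U * pairSwap * Uᵀ) = (2 : ℝ) • (U * Uᵀ) := by
    calc U * pairSwap * Uᵀ * (U * pairSwap * Uᵀ)
        = U * (pairSwap * (Uᵀ * U) * pairSwap) * Uᵀ := by simp only [Matrix.mul_assoc]
      _ = (2 : ℝ) • (U * Uᵀ) := by simp [hU, pairSwap_mul_self]
  have hproj : U * Uᵀ * (U * Uᵀ) = (2 : ℝ) • (U * Uᵀ) := by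
    calc U * Uᵀ * (U * Uᵀ) = U * (Uᵀ * U) * Uᵀ := by simp only [Matrix.mul_assoc]
      _ = (2 : ℝ) • (U * Uᵀ) := by simp [hU]
  have htr : (U * Uᵀ).trace = 12 := by
    rw [Matrix.trace_mul_comm, hU]
    norm_num
  rw [Matrix.mul_assoc (U * pairSwap * Uᵀ * (U * pairSwap * Uᵀ)), hsq, Matrix.smul_mul,
    Matrix.mul_smul, hproj]
  simp only [Matrix.trace_smul, htr, smul_eq_mul]
  norm_num
end

section
/- For every natural number ℓ, the even moments of the Wigner semicircle distribution are the Catalan numbers: ∫_{−2}^{2} x^{2ℓ} · √(4 − x²) dx = 2π · Catalan(ℓ), where Catalan(ℓ) = (1/(ℓ+1))·binomial(2ℓ, ℓ). -/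
theorem integral_cos_pow_even_zero_pi (n : ℕ) :
    ∫ t in (0 : ℝ)..Real.pi, Real.cos t ^ (2 * n) = Real.pi * (n.centralBinom / 4 ^ n) := by
  induction n with
  | zero => simp
  | succ k ih =>
    have h : ((k : ℝ) + 1) * (k + 1).centralBinom = 2 * (2 * k + 1) * k.centralBinom :=
      mod_cast Nat.succ_mul_centralBinom_succ k
    have h' : ((k + 1).centralBinom : ℝ) = 2 * (2 * k + 1) * k.centralBinom / (k + 1) := by
      field_simp
      linear_combination h
    rw [mul_add, mul_one, integral_cos_pow, ih, h']
    simp only [Real.sin_pi, Real.sin_zero]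
    push_cast
    field_simp
    ring

theorem integral_pow_mul_sqrt_four_sub_sq (n : ℕ) :
    ∫ x in (-2 : ℝ)..2, x ^ (2 * n) * Real.sqrt (4 - x ^ 2) =
      ∫ t in (0 : ℝ)..Real.pi,
        4 ^ (n + 1) * (Real.cos t ^ (2 * n) - Real.cos t ^ (2 * (n + 1))) := by
  have h := intervalIntegral.integral_comp_mul_deriv (a := 0) (b := Real.pi)
    (f := fun t => -2 * Real.cos t) (f' := fun t => 2 * Real.sin t)
    (g := fun x => x ^ (2 * n) * Real.sqrt (4 - x ^ 2))
    (fun t _ => by simpa using (Real.hasDerivAt_cos t).const_mul (-2))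
    (by fun_prop) (by fun_prop)
  norm_num only [Real.cos_zero, Real.cos_pi] at h
  rw [← h]
  refine intervalIntegral.integral_congr fun t ht => ?_
  rw [Set.uIcc_of_le Real.pi_pos.le] at ht
  have hs : Real.sqrt (4 - (-2 * Real.cos t) ^ 2) = 2 * Real.sin t := by
    rw [← Real.sqrt_sq (mul_nonneg zero_le_two (Real.sin_nonneg_of_mem_Icc ht))]
    congr 1
    linear_combination -4 * Real.sin_sq_add_cos_sq t
  simp only [Function.comp_apply, hs]
  rw [mul_pow, pow_mul (-2 : ℝ) 2 n]
  norm_num only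
  rw [mul_add 2 n 1, pow_add (Real.cos t)]
  linear_combination 4 ^ (n + 1) * Real.cos t ^ (2 * n) * Real.sin_sq_add_cos_sq t


/-- For every natural number `ℓ`, the even moments of the Wigner semicircle
distribution are the Catalan numbers:
`∫_{−2}^{2} x^{2ℓ} · √(4 − x²) dx = 2π · Catalan(ℓ)`, where
`Catalan(ℓ) = (1/(ℓ+1))·binomial(2ℓ, ℓ)`. -/
theorem semicircle_even_moments_catalan (ℓ : ℕ) :
    ∫ x in (-2 : ℝ)..2, x ^ (2 * ℓ) * Real.sqrt (4 - x ^ 2)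
      = 2 * Real.pi * ((Nat.choose (2 * ℓ) ℓ : ℝ) / (ℓ + 1)) := by
  have h : ((ℓ : ℝ) + 1) * (ℓ + 1).centralBinom = 2 * (2 * ℓ + 1) * ℓ.centralBinom :=
    mod_cast Nat.succ_mul_centralBinom_succ ℓ
  have hint (k : ℕ) : IntervalIntegrable (fun t => Real.cos t ^ k) MeasureTheory.volume 0 Real.pi :=
    (by fun_prop : Continuous fun t => Real.cos t ^ k).intervalIntegrable _ _
  rw [integral_pow_mul_sqrt_four_sub_sq, intervalIntegral.integral_const_mul,
    intervalIntegral.integral_sub (hint _) (hint _), integral_cos_pow_even_zero_pi,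
    integral_cos_pow_even_zero_pi, ← Nat.centralBinom_eq_two_mul_choose]
  field_simp
  linear_combination -4 ^ ℓ * h
end

section
/- For all μ, ν ∈ {0,…,2n−1}, the Jordan–Wigner Majorana operators satisfy the Clifford anticommutation relations C_μ · C_ν + C_ν · C_μ = 2·δ_{μν}·I, where I is the 2ⁿ×2ⁿ identity matrix and δ is the Kronecker delta. -/
open Matrix

/-- The single-qubit Pauli matrices `σ₀ = I`, `σ₁ = X`, `σ₂ = Y`, `σ₃ = Z`. -/
noncomputable def pauli : Fin 4 → Matrix (Fin 2) (Fin 2) ℂ :=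
  ![!![1, 0; 0, 1], !![0, 1; 1, 0], !![0, -Complex.I; Complex.I, 0], !![1, 0; 0, -1]]

/-- The `n`-qubit Pauli string `σ_{f(0)} ⊗ ⋯ ⊗ σ_{f(n-1)}` as a `2ⁿ × 2ⁿ` matrix indexed by
bit strings. -/
noncomputable def pauliString (n : ℕ) (f : Fin n → Fin 4) :
    Matrix (Fin n → Fin 2) (Fin n → Fin 2) ℂ :=
  Matrix.of fun x y => ∏ j, pauli (f j) (x j) (y j)

/-- The Jordan–Wigner Majorana operator `C_μ` on `n` qubits: writing `μ = 2q + r`, it is the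
Kronecker product whose `j`-th factor is `Z` for `j < q`, is `X` (if `r = 0`) or `Y`
(if `r = 1`) for `j = q`, and is the identity for `j > q`. -/
noncomputable def majorana (n : ℕ) (μ : Fin (2 * n)) :
    Matrix (Fin n → Fin 2) (Fin n → Fin 2) ℂ :=
  pauliString n fun j =>
    if (j : ℕ) < (μ : ℕ) / 2 then 3
    else if (j : ℕ) = (μ : ℕ) / 2 then (if (μ : ℕ) % 2 = 0 then 1 else 2)
    else 0

theorem pauli_mul_self (a : Fin 4) : pauli a * pauli a = 1 := by
  fin_cases a <;> ext i j <;> fin_cases i <;> fin_cases j <;> simp [pauli]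

theorem pauli_mul_eq_neg {a b : Fin 4} (ha : a ≠ 0) (hb : b ≠ 0) (hab : a ≠ b) :
    pauli a * pauli b = -(pauli b * pauli a) := by
  fin_cases a <;> fin_cases b <;> first
    | exact absurd rfl ha
    | exact absurd rfl hb
    | exact absurd rfl hab
    | ext i j; fin_cases i <;> fin_cases j <;> simp [pauli]

theorem pauli_zero : pauli 0 = 1 := by
  simp [pauli, Matrix.one_fin_two]

theorem pauliString_mul_apply (n : ℕ) (f g : Fin n → Fin 4) (x y : Fin n → Fin 2) :
    (pauliString n f * pauliString n g) x y = ∏ j, (pauli (f j) * pauli (g j)) (x j) (y j) := by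
  simp only [pauliString, Matrix.mul_apply, Matrix.of_apply, ← Finset.prod_mul_distrib]
  rw [Finset.prod_univ_sum, Fintype.piFinset_univ]

theorem pauliString_mul_self (n : ℕ) (f : Fin n → Fin 4) :
    pauliString n f * pauliString n f = 1 := by
  ext x y
  rw [pauliString_mul_apply]
  simp only [pauli_mul_self, Matrix.one_apply, Finset.prod_ite_zero, Finset.prod_const_one,
    Finset.mem_univ, true_imp_iff, funext_iff]

/-- Pauli strings that anticommute at one site and commute at every other site anticommute. -/
theorem pauliString_mul_eq_neg {n : ℕ} {f g : Fin n → Fin 4} (k : Fin n)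
    (hk : pauli (f k) * pauli (g k) = -(pauli (g k) * pauli (f k)))
    (hcomm : ∀ j, j ≠ k → Commute (pauli (f j)) (pauli (g j))) :
    pauliString n f * pauliString n g = -(pauliString n g * pauliString n f) := by
  ext x y
  rw [Matrix.neg_apply, pauliString_mul_apply, pauliString_mul_apply,
    ← Finset.mul_prod_erase _ _ (Finset.mem_univ k),
    ← Finset.mul_prod_erase _ _ (Finset.mem_univ k), hk, Matrix.neg_apply, neg_mul]
  congr 2
  refine Finset.prod_congr rfl fun j hj => ?_
  rw [(hcomm j (Finset.ne_of_mem_erase hj)).eq]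

theorem majorana_mul_eq_neg {n : ℕ} {μ ν : Fin (2 * n)} (hne : μ ≠ ν)
    (hle : (μ : ℕ) / 2 ≤ (ν : ℕ) / 2) :
    majorana n μ * majorana n ν = -(majorana n ν * majorana n μ) := by
  have hne' : (μ : ℕ) ≠ ν := Fin.val_ne_of_ne hne
  refine pauliString_mul_eq_neg ⟨(μ : ℕ) / 2, by omega⟩ ?_ fun j hj => ?_
  · apply pauli_mul_eq_neg <;> dsimp only <;> split_ifs <;> first | decide | omega
  · have hj' : (j : ℕ) ≠ (μ : ℕ) / 2 := fun h => hj (Fin.ext h)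
    by_cases hlt : (j : ℕ) < (μ : ℕ) / 2
    · rw [if_pos hlt, if_pos (hlt.trans_le hle)]
    · rw [if_neg hlt, if_neg hj', pauli_zero]
      exact Commute.one_left _

/-- For all `μ, ν ∈ {0,…,2n−1}`, the Jordan–Wigner Majorana operators
satisfy the Clifford anticommutation relations `C_μ C_ν + C_ν C_μ = 2 δ_{μν} I`. -/
theorem majorana_anticommutation (n : ℕ) (μ ν : Fin (2 * n)) :
    majorana n μ * majorana n ν + majorana n ν * majorana n μ
      = if μ = ν then (2 : ℂ) • (1 : Matrix (Fin n → Fin 2) (Fin n → Fin 2) ℂ) else 0 := by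
  split_ifs with h
  · rw [h, majorana, pauliString_mul_self, two_smul]
  · rcases le_total ((μ : ℕ) / 2) ((ν : ℕ) / 2) with hle | hle
    · rw [majorana_mul_eq_neg h hle, neg_add_cancel]
    · rw [majorana_mul_eq_neg (Ne.symm h) hle, add_neg_cancel]
end

section
/- Let n = 4 and θ ∈ ℝ, and define the extent (magic) state vector φ_θ ∈ ℂ^{16}, indexed by bit strings z ∈ {0,1}⁴, by φ_θ(z) = cos(θ/4) if z = 0000, φ_θ(z) = sin(θ/4) if z = 1111, and φ_θ(z) = 0 otherwise. Then for all μ ≠ ν ∈ {0,…,7}, ⟨φ_θ, C_μ C_ν φ_θ⟩ = i·cos(θ/2)·J_{μν}, where J is the 8×8 symplectic identity. (Hence the two-Majorana frame-coefficient matrix of the magic state is cos(θ/2) times that of the all-zero Gaussian state.) -/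
open Matrix

/-- The four-qubit extent (magic) state vector `φ_θ ∈ ℂ^{16}`:
`φ_θ(0000) = cos(θ/4)`, `φ_θ(1111) = sin(θ/4)`, and `φ_θ(z) = 0` otherwise. -/
noncomputable def phiTheta (θ : ℝ) : (Fin 4 → Fin 2) → ℂ := fun z =>
  if z = (fun _ => 0) then (Real.cos (θ / 4) : ℂ)
  else if z = (fun _ => 1) then (Real.sin (θ / 4) : ℂ)
  else 0

/-- A sum weighted by the magic state only sees the bit strings `0000` and `1111`. -/
theorem sum_mul_phiTheta (θ : ℝ) (F : (Fin 4 → Fin 2) → ℂ) :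
    ∑ z, F z * phiTheta θ z
      = F (fun _ => 0) * Real.cos (θ / 4) + F (fun _ => 1) * Real.sin (θ / 4) := by
  have h : (fun _ => 0 : Fin 4 → Fin 2) ≠ fun _ => 1 := by decide
  rw [Fintype.sum_eq_add (fun _ => 0) (fun _ => 1) h]
  · simp only [phiTheta, if_true, h.symm, if_false]
  · rintro z ⟨h0, h1⟩
    simp [phiTheta, h0, h1]

theorem conj_phiTheta (θ : ℝ) (z : Fin 4 → Fin 2) :
    (starRingEnd ℂ) (phiTheta θ z) = phiTheta θ z := by
  unfold phiTheta
  split_ifs <;> simp only [Complex.conj_ofReal, map_zero]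

/-- The expectation of an operator in the magic state. -/
theorem phiTheta_expectation (θ : ℝ) (M : Matrix (Fin 4 → Fin 2) (Fin 4 → Fin 2) ℂ) :
    ∑ z, (starRingEnd ℂ) (phiTheta θ z) * (M.mulVec (phiTheta θ)) z
      = (M (fun _ => 0) (fun _ => 0) * Real.cos (θ / 4)
          + M (fun _ => 0) (fun _ => 1) * Real.sin (θ / 4)) * Real.cos (θ / 4)
        + (M (fun _ => 1) (fun _ => 0) * Real.cos (θ / 4)
          + M (fun _ => 1) (fun _ => 1) * Real.sin (θ / 4)) * Real.sin (θ / 4) := by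
  simp only [conj_phiTheta, Matrix.mulVec, dotProduct, sum_mul_phiTheta]
  simp only [mul_comm (phiTheta θ _)]
  rw [sum_mul_phiTheta]

theorem cos_half_eq (θ : ℝ) :
    (Real.cos (θ / 2) : ℂ) = (Real.cos (θ / 4) : ℂ) ^ 2 - (Real.sin (θ / 4) : ℂ) ^ 2 := by
  rw [show θ / 2 = 2 * (θ / 4) by ring, Real.cos_two_mul']
  push_cast
  ring

/-- Let `n = 4` and `θ ∈ ℝ`.  For all `μ ≠ ν ∈ {0,…,7}`,
`⟨φ_θ, C_μ C_ν φ_θ⟩ = i·cos(θ/2)·J_{μν}`, where `J` is the `8 × 8` symplectic identity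
and `⟨u, v⟩ = Σ_z conj(u(z))·v(z)`. -/
theorem magic_state_two_majorana_coefficients (θ : ℝ) (μ ν : Fin (2 * 4)) (hμν : μ ≠ ν) :
    ∑ z, (starRingEnd ℂ) (phiTheta θ z)
        * ((majorana 4 μ * majorana 4 ν).mulVec (phiTheta θ)) z
      = Complex.I * (Real.cos (θ / 2) : ℂ) * (symplJ 4 μ ν : ℂ) := by
  rw [phiTheta_expectation, cos_half_eq]
  simp only [majorana, pauliString_mul_apply, Fin.prod_univ_four]
  generalize (Real.cos (θ / 4) : ℂ) = c
  generalize (Real.sin (θ / 4) : ℂ) = s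
  fin_cases μ <;> fin_cases ν <;>
    first
    | exact absurd rfl hμν
    | (simp [pauli, symplJ]; done)
    | (simp [pauli, symplJ]; ring)
end

section
/- Let m ≥ 1 and let k be an odd positive integer. Let σ be a fixed-point-free involution of the set {1,…,k}×{1,…,m} (a permutation with σ∘σ = id and σ(x) ≠ x for all x), and let c : {1,…,k}×{1,…,m} → {1,…,m} satisfy c(σ(x)) = c(x) for all x. Then there exists j ∈ {1,…,k} such that the map i ↦ c(j, i) is not a bijection of {1,…,m}. (Consequently every summand in any Brauer-pairing contraction of an odd number k of copies of the rank-m generalized antisymmetric Kronecker delta vanishes, which is the combinatorial core of the paper's proof that all odd moments vanish for observables built from mutually disjoint Majorana products.) -/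
/-- A finite set stable under a fixed-point-free involution has even cardinality. -/
theorem Finset.even_card_of_fixedPointFree_involution {α : Type*} (s : Finset α) (f : α → α)
    (hmem : ∀ x ∈ s, f x ∈ s) (hinvol : ∀ x ∈ s, f (f x) = x) (hfpf : ∀ x ∈ s, f x ≠ x) :
    Even s.card := by
  have hsum : ∑ _x ∈ s, (1 : ZMod 2) = 0 :=
    Finset.sum_involution (fun x _ => f x) (fun _ _ => by decide)
      (fun x hx _ => hfpf x hx) hmem hinvol
  rw [← ZMod.natCast_eq_zero_iff_even]
  simpa using hsum

/-- If every row of a coloring is a bijection, each color occurs exactly once per row. -/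
theorem card_color_fiber_of_rows_bijective {ι κ γ : Type*} [Fintype ι] [Fintype κ]
    [DecidableEq γ] (c : κ × ι → γ) (hc : ∀ j, Function.Bijective fun i => c (j, i)) (a : γ) :
    (Finset.univ.filter fun x => c x = a).card = Fintype.card κ := by
  choose g hg using fun j => (hc j).surjective a
  symm
  refine Finset.card_bij (fun j _ => (j, g j)) (by simpa using hg) (by simp) ?_
  rintro ⟨j, i⟩ hx
  refine ⟨j, Finset.mem_univ j, Prod.ext rfl ((hc j).injective ?_)⟩
  exact (hg j).trans (Finset.mem_filter.mp hx).2.symm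

/-- Let `m ≥ 1` and let `k` be an odd positive integer.  Let `σ` be a
fixed-point-free involution of `{1,…,k} × {1,…,m}` and let
`c : {1,…,k} × {1,…,m} → {1,…,m}` satisfy `c(σ(x)) = c(x)` for all `x`.  Then there exists
`j ∈ {1,…,k}` such that the map `i ↦ c(j, i)` is not a bijection of `{1,…,m}`. -/
theorem odd_copies_coloring_not_all_bijective
    (m k : ℕ) (hm : 1 ≤ m) (hk : Odd k) (hkpos : 0 < k)
    (σ : Equiv.Perm (Fin k × Fin m))
    (hinvol : ∀ x, σ (σ x) = x) (hfpf : ∀ x, σ x ≠ x)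
    (c : Fin k × Fin m → Fin m) (hc : ∀ x, c (σ x) = c x) :
    ∃ j : Fin k, ¬ Function.Bijective (fun i : Fin m => c (j, i)) := by
  by_contra! hbij
  have hcard := card_color_fiber_of_rows_bijective c hbij ⟨0, hm⟩
  rw [Fintype.card_fin] at hcard
  refine Nat.not_even_iff_odd.mpr hk (hcard ▸ ?_)
  exact Finset.even_card_of_fixedPointFree_involution _ σ (by simp [hc])
    (fun x _ => hinvol x) (fun x _ => hfpf x)
end

section
/- Let t, d ≥ 1 be integers and let (Ω, ℙ) and ξ be as defined. Then ℙ( ξ² > d/(2t²) ) ≥ 1/36. (Equivalently, with total measurement budget T = 2dt, the error of the naive indirect matchgate-kernel estimator on the hard instance exceeds √(2d³)/T with probability at least 1/36, establishing the lower bound that separates the indirect protocol from the direct Bell-measurement protocol.) -/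
/-- The probability that a `Bin(t, 1/2)` random variable equals `b`. -/
noncomputable def binWeight (t : ℕ) (b : Fin (t + 1)) : ℝ := (t.choose b : ℝ) / 2 ^ t

/-- The probability of the outcome `ω` in the sample space
`Ω = {0,…,t}^d × {0,…,t}^d` equipped with the product, over all `2d` coordinates, of the
binomial distribution `Bin(t, 1/2)`. -/
noncomputable def prodBinProb (t d : ℕ)
    (ω : (Fin d → Fin (t + 1)) × (Fin d → Fin (t + 1))) : ℝ :=
  (∏ i, binWeight t (ω.1 i)) * (∏ i, binWeight t (ω.2 i))

/-- The single-coefficient estimate `X(b) = 2b/t − 1`. -/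
noncomputable def Xest (t : ℕ) (b : Fin (t + 1)) : ℝ := 2 * (b : ℝ) / t - 1

/-- The indirect kernel-overlap estimator `ξ(u, v) = Σ_{i=1}^{d} X(u_i)·X(v_i)`. -/
noncomputable def xiEst (t d : ℕ)
    (ω : (Fin d → Fin (t + 1)) × (Fin d → Fin (t + 1))) : ℝ :=
  ∑ i, Xest t (ω.1 i) * Xest t (ω.2 i)

/-- Pascal's rule, summed against an arbitrary function. -/
lemma sum_range_choose_succ_mul (t : ℕ) (g : ℕ → ℝ) :
    ∑ b ∈ Finset.range (t + 2), ((t + 1).choose b : ℝ) * g b =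
      ∑ b ∈ Finset.range (t + 1), (t.choose b : ℝ) * (g b + g (b + 1)) := by
  rw [Finset.sum_choose_succ_mul (fun i _ => g i) t, add_comm, ← Finset.sum_add_distrib]
  exact Finset.sum_congr rfl fun b _ => by ring

lemma sum_choose_mul_centered (t : ℕ) :
    ∑ b ∈ Finset.range (t + 1), (t.choose b : ℝ) * (2 * b - t) = 0 := by
  induction t with
  | zero => simp
  | succ t ih =>
    rw [sum_range_choose_succ_mul t (fun b => 2 * (b : ℝ) - ((t + 1 : ℕ) : ℝ)),
      Finset.sum_congr rfl (g := fun b : ℕ => 2 * ((t.choose b : ℝ) * (2 * b - t)))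
        (fun b _ => by push_cast; ring), ← Finset.mul_sum, ih, mul_zero]

lemma sum_choose_cast (t : ℕ) :
    ∑ b ∈ Finset.range (t + 1), (t.choose b : ℝ) = 2 ^ t := by
  exact_mod_cast Nat.sum_range_choose t

lemma sum_choose_mul_centered_sq (t : ℕ) :
    ∑ b ∈ Finset.range (t + 1), (t.choose b : ℝ) * (2 * (b : ℝ) - t) ^ 2 = (2 : ℝ) ^ t * t := by
  induction t with
  | zero => simp
  | succ t ih =>
    rw [sum_range_choose_succ_mul t (fun b => (2 * (b : ℝ) - ((t + 1 : ℕ) : ℝ)) ^ 2),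
      Finset.sum_congr rfl
        (g := fun b : ℕ => 2 * ((t.choose b : ℝ) * (2 * b - t) ^ 2) + 2 * (t.choose b : ℝ))
        (fun b _ => by push_cast; ring), Finset.sum_add_distrib, ← Finset.mul_sum,
      ← Finset.mul_sum, ih, sum_choose_cast]
    push_cast
    ring

lemma sum_choose_mul_centered_pow_four (t : ℕ) :
    ∑ b ∈ Finset.range (t + 1), (t.choose b : ℝ) * (2 * (b : ℝ) - t) ^ 4 =
      (2 : ℝ) ^ t * (3 * (t : ℝ) ^ 2 - 2 * t) := by
  induction t with
  | zero => simp
  | succ t ih =>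
    rw [sum_range_choose_succ_mul t (fun b => (2 * (b : ℝ) - ((t + 1 : ℕ) : ℝ)) ^ 4),
      Finset.sum_congr rfl
        (g := fun b : ℕ => 2 * ((t.choose b : ℝ) * (2 * b - t) ^ 4) +
          12 * ((t.choose b : ℝ) * (2 * b - t) ^ 2) + 2 * (t.choose b : ℝ))
        (fun b _ => by push_cast; ring), Finset.sum_add_distrib, Finset.sum_add_distrib,
      ← Finset.mul_sum, ← Finset.mul_sum, ← Finset.mul_sum, ih, sum_choose_cast,
      sum_choose_mul_centered_sq]
    push_cast
    ring

lemma sum_binWeight (t : ℕ) : ∑ b, binWeight t b = 1 := by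
  simp only [binWeight]
  rw [Fin.sum_univ_eq_sum_range (fun b => (t.choose b : ℝ) / 2 ^ t), ← Finset.sum_div,
    sum_choose_cast, div_self (by positivity)]

lemma sum_binWeight_mul_Xest_pow (t : ℕ) (ht : 1 ≤ t) (n : ℕ) :
    ∑ b, binWeight t b * Xest t b ^ n =
      (∑ b ∈ Finset.range (t + 1), (t.choose b : ℝ) * (2 * (b : ℝ) - t) ^ n) / (2 ^ t * t ^ n) := by
  have ht' : (t : ℝ) ≠ 0 := by positivity
  simp only [binWeight, Xest]
  rw [Fin.sum_univ_eq_sum_range (fun b => (t.choose b : ℝ) / 2 ^ t * (2 * (b : ℝ) / t - 1) ^ n),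
    Finset.sum_div]
  refine Finset.sum_congr rfl fun b _ => ?_
  rw [div_sub_one ht', div_pow, div_mul_div_comm]

section ProductMoments

variable {B : Type*} [Fintype B] (w f : B → ℝ)

/-- Expectation of a function of a sum of `d` independent copies of `f` under the weight `w`. -/
def sumExpect (d : ℕ) (g : ℝ → ℝ) : ℝ :=
  ∑ ω : Fin d → B, (∏ i, w (ω i)) * g (∑ i, f (ω i))

lemma sumExpect_zero (g : ℝ → ℝ) : sumExpect w f 0 g = g 0 := by
  simp [sumExpect]

lemma sumExpect_succ (d : ℕ) (g : ℝ → ℝ) :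
    sumExpect w f (d + 1) g = sumExpect w f d fun s => ∑ b, w b * g (f b + s) := by
  unfold sumExpect
  rw [← (Fin.consEquiv fun _ : Fin (d + 1) => B).sum_comp, Fintype.sum_prod_type, Finset.sum_comm]
  refine Finset.sum_congr rfl fun ω _ => ?_
  rw [Finset.mul_sum]
  refine Finset.sum_congr rfl fun b _ => ?_
  simp [Fin.consEquiv, Fin.prod_univ_succ, Fin.sum_univ_succ]
  ring

lemma sumExpect_add (d : ℕ) (g h : ℝ → ℝ) :
    sumExpect w f d (fun s => g s + h s) = sumExpect w f d g + sumExpect w f d h := by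
  simp only [sumExpect, mul_add, Finset.sum_add_distrib]

lemma sumExpect_const_mul (d : ℕ) (c : ℝ) (g : ℝ → ℝ) :
    sumExpect w f d (fun s => c * g s) = c * sumExpect w f d g := by
  simp only [sumExpect, Finset.mul_sum]
  exact Finset.sum_congr rfl fun _ _ => by ring

variable {w f}

lemma sumExpect_one (h0 : ∑ b, w b = 1) (d : ℕ) : sumExpect w f d (fun _ => 1) = 1 := by
  induction d with
  | zero => rw [sumExpect_zero]
  | succ d ih => rw [sumExpect_succ]; simpa [h0] using ih

lemma sumExpect_id (h0 : ∑ b, w b = 1) (h1 : ∑ b, w b * f b = 0) (d : ℕ) :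
    sumExpect w f d (fun s => s) = 0 := by
  induction d with
  | zero => rw [sumExpect_zero]
  | succ d ih =>
    rw [sumExpect_succ]
    simpa [mul_add, Finset.sum_add_distrib, h1, ← Finset.sum_mul, h0] using ih

lemma sumExpect_sq (h0 : ∑ b, w b = 1) (h1 : ∑ b, w b * f b = 0) (d : ℕ) :
    sumExpect w f d (fun s => s ^ 2) = d * ∑ b, w b * f b ^ 2 := by
  induction d with
  | zero => simp [sumExpect_zero]
  | succ d ih =>
    have key (s : ℝ) : ∑ b, w b * (f b + s) ^ 2 = (∑ b, w b * f b ^ 2) * 1 + s ^ 2 := by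
      calc _ = ∑ b, (w b * f b ^ 2 + 2 * s * (w b * f b) + s ^ 2 * w b) :=
            Finset.sum_congr rfl fun b _ => by ring
        _ = _ := by
          simp only [Finset.sum_add_distrib, ← Finset.mul_sum, h0, h1]
          ring
    rw [sumExpect_succ]
    simp only [key]
    rw [sumExpect_add, sumExpect_const_mul, sumExpect_one h0, ih]
    push_cast
    ring

lemma sumExpect_pow_four (h0 : ∑ b, w b = 1) (h1 : ∑ b, w b * f b = 0) (d : ℕ) :
    sumExpect w f d (fun s => s ^ 4) =
      d * ∑ b, w b * f b ^ 4 + 3 * d * (d - 1) * (∑ b, w b * f b ^ 2) ^ 2 := by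
  induction d with
  | zero => simp [sumExpect_zero]
  | succ d ih =>
    have key (s : ℝ) : ∑ b, w b * (f b + s) ^ 4 =
        (∑ b, w b * f b ^ 4) * 1 + (4 * ∑ b, w b * f b ^ 3) * s +
          (6 * ∑ b, w b * f b ^ 2) * s ^ 2 + s ^ 4 := by
      calc _ = ∑ b, (w b * f b ^ 4 + 4 * s * (w b * f b ^ 3) + 6 * s ^ 2 * (w b * f b ^ 2) +
              4 * s ^ 3 * (w b * f b) + s ^ 4 * w b) :=
            Finset.sum_congr rfl fun b _ => by ring
        _ = _ := by
          simp only [Finset.sum_add_distrib, ← Finset.mul_sum, h0, h1]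
          ring
    rw [sumExpect_succ]
    simp only [key]
    rw [sumExpect_add, sumExpect_add, sumExpect_add, sumExpect_const_mul, sumExpect_const_mul,
      sumExpect_const_mul, sumExpect_one h0, sumExpect_id h0 h1, sumExpect_sq h0 h1, ih]
    push_cast
    ring

end ProductMoments

lemma sum_prodBinProb_mul (t d : ℕ) (g : ℝ → ℝ) :
    ∑ ω, prodBinProb t d ω * g (xiEst t d ω) =
      sumExpect (fun p : Fin (t + 1) × Fin (t + 1) => binWeight t p.1 * binWeight t p.2)
        (fun p => Xest t p.1 * Xest t p.2) d g := by
  unfold sumExpect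
  rw [← (Equiv.arrowProdEquivProdArrow (Fin d) (fun _ => Fin (t + 1))
    (fun _ => Fin (t + 1))).sum_comp]
  refine Finset.sum_congr rfl fun ω _ => ?_
  simp [prodBinProb, xiEst, Equiv.arrowProdEquivProdArrow, Finset.prod_mul_distrib]

/-- Moments of the product of two independent single-coefficient estimates. -/
lemma sum_binWeight_prod_mul_pow (t n : ℕ) :
    ∑ p : Fin (t + 1) × Fin (t + 1),
        (binWeight t p.1 * binWeight t p.2) * (Xest t p.1 * Xest t p.2) ^ n =
      (∑ b, binWeight t b * Xest t b ^ n) ^ 2 := by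
  rw [sq, Finset.sum_mul_sum, Fintype.sum_prod_type]
  exact Finset.sum_congr rfl fun a _ => Finset.sum_congr rfl fun b _ => by ring

lemma prodBinProb_nonneg (t d : ℕ) (ω : (Fin d → Fin (t + 1)) × (Fin d → Fin (t + 1))) :
    0 ≤ prodBinProb t d ω := by
  unfold prodBinProb binWeight
  positivity

/-- The quadratic lower bound for an indicator behind the Paley–Zygmund inequality. -/
lemma quadratic_le_indicator {m z : ℝ} (hm : 0 < m) :
    (z / m - 1 / 2) / 9 - (z / m) ^ 2 / 324 ≤ if m / 2 < z then 1 else 0 := by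
  split_ifs with h
  · nlinarith [sq_nonneg (z / m / 18 - 1)]
  · have : z / m ≤ 1 / 2 := by
      rw [div_le_iff₀ hm]
      linarith
    nlinarith [sq_nonneg (z / m)]

/-- Let `t, d ≥ 1`.  For the estimator `ξ` on the product binomial
probability space `(Ω, ℙ)`, one has `ℙ(ξ² > d/(2t²)) ≥ 1/36`.  (Equivalently, with total
measurement budget `T = 2dt`, the error of the naive indirect matchgate-kernel estimator on
the hard instance exceeds `√(2d³)/T` with probability at least `1/36`.) -/
theorem indirect_estimator_lower_bound (t d : ℕ) (ht : 1 ≤ t) (hd : 1 ≤ d) :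
    (1 : ℝ) / 36 ≤
      ∑ ω ∈ Finset.univ.filter
          (fun ω : (Fin d → Fin (t + 1)) × (Fin d → Fin (t + 1)) =>
            (d : ℝ) / (2 * (t : ℝ) ^ 2) < (xiEst t d ω) ^ 2),
        prodBinProb t d ω := by
  have ht' : (0 : ℝ) < t := by exact_mod_cast ht
  have hd' : (1 : ℝ) ≤ d := by exact_mod_cast hd
  have h0 : ∑ p : Fin (t + 1) × Fin (t + 1), binWeight t p.1 * binWeight t p.2 = 1 := by
    simpa [sum_binWeight] using sum_binWeight_prod_mul_pow t 0
  have h1 : ∑ p : Fin (t + 1) × Fin (t + 1),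
      (binWeight t p.1 * binWeight t p.2) * (Xest t p.1 * Xest t p.2) = 0 := by
    have h := sum_binWeight_prod_mul_pow t 1
    rw [sum_binWeight_mul_Xest_pow t ht] at h
    simpa [sum_choose_mul_centered] using h
  have h2 := sum_prodBinProb_mul t d (fun s => s ^ 2)
  rw [sumExpect_sq h0 h1, sum_binWeight_prod_mul_pow, sum_binWeight_mul_Xest_pow t ht,
    sum_choose_mul_centered_sq, mul_div_mul_left _ _ (by positivity)] at h2
  have h4 := sum_prodBinProb_mul t d (fun s => s ^ 4)
  rw [sumExpect_pow_four h0 h1, sum_binWeight_prod_mul_pow, sum_binWeight_prod_mul_pow,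
    sum_binWeight_mul_Xest_pow t ht, sum_binWeight_mul_Xest_pow t ht,
    sum_choose_mul_centered_sq, sum_choose_mul_centered_pow_four,
    mul_div_mul_left _ _ (by positivity), mul_div_mul_left _ _ (by positivity)] at h4
  have hmass : ∑ ω, prodBinProb t d ω = 1 := by
    simpa [sumExpect_one h0] using sum_prodBinProb_mul t d (fun _ => 1)
  set m : ℝ := d / t ^ 2 with hm_def
  have hm : 0 < m := by positivity
  have hsecond : ∑ ω, prodBinProb t d ω * xiEst t d ω ^ 2 = m := by
    rw [h2, hm_def]
    field_simp
  have hfourth : ∑ ω, prodBinProb t d ω * xiEst t d ω ^ 4 ≤ 9 * m ^ 2 := by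
    have hX : (3 * (t : ℝ) ^ 2 - 2 * t) / t ^ 4 ≤ 3 / t ^ 2 := by
      rw [div_le_div_iff₀ (by positivity) (by positivity)]
      nlinarith [pow_pos ht' 3]
    have hX0 : 0 ≤ (3 * (t : ℝ) ^ 2 - 2 * t) / t ^ 4 := by
      have : (1 : ℝ) ≤ t := by exact_mod_cast ht
      exact div_nonneg (by nlinarith) (by positivity)
    calc _ ≤ d * (3 / (t : ℝ) ^ 2) ^ 2 + 3 * d * (d - 1) * (((t : ℝ) / t ^ 2) ^ 2) ^ 2 := by
          rw [h4]
          gcongr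
      _ = (3 * d ^ 2 + 6 * d) / (t : ℝ) ^ 4 := by
          field_simp
          ring
      _ ≤ 9 * d ^ 2 / (t : ℝ) ^ 4 := by
          gcongr
          nlinarith
      _ = 9 * m ^ 2 := by
          rw [hm_def]
          ring
  have hthreshold : (d : ℝ) / (2 * (t : ℝ) ^ 2) = m / 2 := by
    rw [hm_def]
    ring
  rw [hthreshold, Finset.sum_filter]
  calc (1 : ℝ) / 36 ≤ (m / m - 1 / 2) / 9 - 9 * m ^ 2 / m ^ 2 / 324 := by
        rw [div_self hm.ne', mul_div_assoc, div_self (by positivity)]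
        norm_num
    _ ≤ (m / m - 1 / 2) / 9 -
          (∑ ω, prodBinProb t d ω * xiEst t d ω ^ 4) / m ^ 2 / 324 := by gcongr
    _ = ∑ ω, prodBinProb t d ω *
          ((xiEst t d ω ^ 2 / m - 1 / 2) / 9 - (xiEst t d ω ^ 2 / m) ^ 2 / 324) := by
        have hexpand (ω : (Fin d → Fin (t + 1)) × (Fin d → Fin (t + 1))) :
            prodBinProb t d ω *
              ((xiEst t d ω ^ 2 / m - 1 / 2) / 9 - (xiEst t d ω ^ 2 / m) ^ 2 / 324) =
            1 / (9 * m) * (prodBinProb t d ω * xiEst t d ω ^ 2) - 1 / 18 * prodBinProb t d ω -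
              1 / (324 * m ^ 2) * (prodBinProb t d ω * xiEst t d ω ^ 4) := by
          field_simp
          ring
        simp only [hexpand, Finset.sum_sub_distrib, ← Finset.mul_sum]
        rw [hsecond, hmass]
        field_simp
        ring
    _ ≤ _ := Finset.sum_le_sum fun ω _ => by
        simpa using mul_le_mul_of_nonneg_left
          (quadratic_le_indicator (z := xiEst t d ω ^ 2) hm) (prodBinProb_nonneg t d ω)
end
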